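/- arXiv:1312.7388 — 2 statements merged into one kernel-verified Lean document; each statement's English description precedes it below -/
import Mathlib

section
/- Let c ∈ (−1, 1) and λ = √(1 − c²). The curve β(s) = (−2·arctan((e^{λs} + c)/λ) − c·s, ln(e^{λs} + e^{−λs} + 2c)), s ∈ ℝ, is parametrized by arc length and has constant weighted curvature c: x'(s)y''(s) − x''(s)y'(s) − x'(s) = c for all s ∈ ℝ. -/
open Real

/-- For `-1 < c`, the expression `e^t + e^{-t} + 2c` is positive. -/
lemma exp_add_exp_neg_add_two_mul_pos {c : ℝ} (hc : -1 < c) (t : ℝ) :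
    0 < exp t + exp (-t) + 2 * c := by
  have h : exp t * exp (-t) = 1 := by rw [← exp_add]; simp
  nlinarith [sq_nonneg (exp t - exp (-t)), exp_pos t, exp_pos (-t)]

lemma hasDerivAt_exp_mul_add_exp_neg_mul (l c s : ℝ) :
    HasDerivAt (fun s => exp (l * s) + exp (-(l * s)) + 2 * c)
      (l * (exp (l * s) - exp (-(l * s)))) s := by
  have h : HasDerivAt (fun s : ℝ => l * s) l s := by simpa using (hasDerivAt_id s).const_mul l
  exact ((h.exp.add h.fun_neg.exp).add_const (2 * c)).congr_deriv (by ring)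

lemma hasDerivAt_exp_mul_sub_exp_neg_mul (l s : ℝ) :
    HasDerivAt (fun s => l * (exp (l * s) - exp (-(l * s))))
      (l ^ 2 * (exp (l * s) + exp (-(l * s)))) s := by
  have h : HasDerivAt (fun s : ℝ => l * s) l s := by simpa using (hasDerivAt_id s).const_mul l
  exact ((h.exp.sub h.fun_neg.exp).const_mul l).congr_deriv (by ring)

lemma hasDerivAt_arctan_exp_mul {l c : ℝ} (hl : 0 < l) (hlc : l ^ 2 = 1 - c ^ 2) (hc : -1 < c)
    (s : ℝ) :
    HasDerivAt (fun s => -2 * arctan ((exp (l * s) + c) / l) - c * s)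
      (-2 * l ^ 2 / (exp (l * s) + exp (-(l * s)) + 2 * c) - c) s := by
  have h : HasDerivAt (fun s : ℝ => l * s) l s := by simpa using (hasDerivAt_id s).const_mul l
  have hcs : HasDerivAt (fun s : ℝ => c * s) c s := by simpa using (hasDerivAt_id s).const_mul c
  refine ((((h.exp.add_const c).div_const l).arctan.const_mul (-2)).sub hcs).congr_deriv ?_
  have hD := exp_add_exp_neg_add_two_mul_pos hc (l * s)
  have hE : exp (l * s) * exp (-(l * s)) = 1 := by rw [← exp_add]; simp
  have hden : 1 + ((exp (l * s) + c) / l) ^ 2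
      = exp (l * s) * (exp (l * s) + exp (-(l * s)) + 2 * c) / l ^ 2 := by
    field_simp
    linear_combination hlc - hE
  have hpos := exp_pos (l * s)
  rw [hden]
  field_simp

/-- For `c ∈ (−1, 1)` and `λ = √(1 − c²)`, the curve
`β(s) = (−2·arctan((e^{λs} + c)/λ) − c·s, ln(e^{λs} + e^{−λs} + 2c))` is parametrized by
arc length and has constant weighted curvature `c` with respect to the density `e^y`. -/
theorem constant_weighted_curvature_curve_second (c : ℝ) (hc : c ∈ Set.Ioo (-1 : ℝ) 1) :
    let l : ℝ := Real.sqrt (1 - c ^ 2)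
    let x : ℝ → ℝ := fun s => -2 * arctan ((exp (l * s) + c) / l) - c * s
    let y : ℝ → ℝ := fun s => log (exp (l * s) + exp (-(l * s)) + 2 * c)
    ∀ s : ℝ,
      deriv x s ^ 2 + deriv y s ^ 2 = 1 ∧
      deriv x s * deriv (deriv y) s - deriv (deriv x) s * deriv y s - deriv x s = c := by
  intro l x y s
  obtain ⟨hc₁, hc₂⟩ := hc
  have hpos : 0 < 1 - c ^ 2 := by nlinarith
  have hl : 0 < l := Real.sqrt_pos.mpr hpos
  have hlc : l ^ 2 = 1 - c ^ 2 := Real.sq_sqrt hpos.le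
  have hD (t : ℝ) := (exp_add_exp_neg_add_two_mul_pos hc₁ (l * t)).ne'
  have hx : deriv x = fun t => -2 * l ^ 2 / (exp (l * t) + exp (-(l * t)) + 2 * c) - c :=
    funext fun t => (hasDerivAt_arctan_exp_mul hl hlc hc₁ t).deriv
  have hy : deriv y = fun t =>
      l * (exp (l * t) - exp (-(l * t))) / (exp (l * t) + exp (-(l * t)) + 2 * c) :=
    funext fun t => ((hasDerivAt_exp_mul_add_exp_neg_mul l c t).log (hD t)).deriv
  have hD' := hasDerivAt_exp_mul_add_exp_neg_mul l c s
  have hxx := (((hasDerivAt_const s (-2 * l ^ 2)).fun_div hD' (hD s)).sub_const c).deriv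
  have hyy := ((hasDerivAt_exp_mul_sub_exp_neg_mul l s).fun_div hD' (hD s)).deriv
  rw [hx, hy, hxx, hyy]
  have hE : exp (l * s) * exp (-(l * s)) = 1 := by rw [← exp_add]; simp
  have hDs := hD s
  clear_value l
  clear hx hy hxx hyy hD hD' x y
  beta_reduce
  generalize exp (l * s) = E at *
  generalize exp (-(l * s)) = F at *
  obtain ⟨D, hDE⟩ : ∃ D, D = E + F + 2 * c := ⟨_, rfl⟩
  obtain ⟨S, hSE⟩ : ∃ S, S = E - F := ⟨_, rfl⟩
  have hS : S ^ 2 = (D - 2 * c) ^ 2 - 4 := by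
    rw [hSE, hDE]; linear_combination -4 * hE
  have hEF : E + F = D - 2 * c := by rw [hDE]; ring
  rw [← hDE] at hDs ⊢
  rw [← hSE, hEF]
  constructor
  · field_simp
    linear_combination l ^ 2 * hS + (D ^ 2 + 4 * l ^ 2) * hlc
  · field_simp
    linear_combination l ^ 2 * c * D * hS + l ^ 2 * D * (4 * c - 2 * D) * hlc
end

section
/- Let c > 1 and μ = √(c² − 1), and let α = (x, y) be the curve on (−π/μ, π/μ) given by x(s) = 2·arctan(√((c−1)/(c+1))·tan(μs/2)) − c·s and y(s) = −ln((tan²(μs/2) + 1)/(((c−1)/(c+1))·tan²(μs/2) + 1)). Then its tangent satisfies x'(s) = (−c·cos(μs) − 1)/(c + cos(μs)), and its Euclidean signed curvature satisfies x'(s)y''(s) − x''(s)y'(s) = (c² − 1)/(c + cos(μs)) for all s ∈ (−π/μ, π/μ). -/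
open Real

/-- Half-angle form of `(1 + tan²) / (r tan² + 1)` with `r = (c - 1) / (c + 1)`. -/
theorem tan_sq_add_one_div_eq {c θ : ℝ} (hc : 1 < c) (hθ : cos (θ / 2) ≠ 0) :
    (tan (θ / 2) ^ 2 + 1) / ((c - 1) / (c + 1) * tan (θ / 2) ^ 2 + 1)
      = (c + 1) / (c + cos θ) := by
  have hcos : cos θ = 2 * cos (θ / 2) ^ 2 - 1 := by
    rw [← cos_two_mul]; ring_nf
  have hD : 0 < c + cos θ := by linarith [neg_one_le_cos θ]
  have hc1 : c + 1 ≠ 0 := by linarith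
  have hden : (c - 1) / (c + 1) * tan (θ / 2) ^ 2 + 1
      = (c + cos θ) / ((c + 1) * cos (θ / 2) ^ 2) := by
    rw [tan_eq_sin_div_cos, div_pow, sin_sq, hcos]
    field_simp
    ring
  have hnum : tan (θ / 2) ^ 2 + 1 = 1 / cos (θ / 2) ^ 2 := by
    rw [tan_eq_sin_div_cos, div_pow, sin_sq]
    field_simp
    ring
  rw [hden, hnum]
  field_simp

theorem sqrt_sq_sub_one_eq {c : ℝ} (hc : 1 < c) :
    √(c ^ 2 - 1) = √((c - 1) / (c + 1)) * (c + 1) := by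
  have hc1 : 0 < c + 1 := by linarith
  rw [show c ^ 2 - 1 = (c - 1) / (c + 1) * (c + 1) ^ 2 by field_simp; ring,
    sqrt_mul (div_nonneg (by linarith) hc1.le), sqrt_sq hc1.le]

theorem hasDerivAt_add_cos_mul (c μ s : ℝ) :
    HasDerivAt (fun s => c + cos (μ * s)) (-(μ * sin (μ * s))) s := by
  have h := (((hasDerivAt_id s).const_mul μ).cos).const_add c
  simp only [id, mul_one] at h
  exact h.congr_deriv (by ring)

theorem hasDerivAt_two_mul_arctan_sub {c s : ℝ} (hc : 1 < c)
    (hs : cos (√(c ^ 2 - 1) * s / 2) ≠ 0) :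
    HasDerivAt (fun s => 2 * arctan (√((c - 1) / (c + 1)) * tan (√(c ^ 2 - 1) * s / 2)) - c * s)
      ((-c * cos (√(c ^ 2 - 1) * s) - 1) / (c + cos (√(c ^ 2 - 1) * s))) s := by
  have hlin : HasDerivAt (fun s => √(c ^ 2 - 1) * s / 2) (√(c ^ 2 - 1) / 2) s := by
    simpa using ((hasDerivAt_id s).const_mul √(c ^ 2 - 1)).div_const 2
  have h := ((((hasDerivAt_tan hs).comp s hlin).const_mul √((c - 1) / (c + 1))).arctan.const_mul
    2).sub ((hasDerivAt_id s).const_mul c)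
  have hratio := tan_sq_add_one_div_eq hc hs
  have hμ := sqrt_sq_sub_one_eq hc
  have hr : √((c - 1) / (c + 1)) ^ 2 = (c - 1) / (c + 1) :=
    sq_sqrt (div_nonneg (by linarith) (by linarith))
  have hD : 0 < c + cos (√(c ^ 2 - 1) * s) := by
    linarith [neg_one_le_cos (√(c ^ 2 - 1) * s)]
  have hc1 : c + 1 ≠ 0 := by linarith
  have hrμ : √((c - 1) / (c + 1)) * √(c ^ 2 - 1) = c - 1 := by
    rw [hμ, ← mul_assoc, ← sq, hr]
    field_simp
  refine h.congr_deriv ?_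
  have hsec : 1 / cos (√(c ^ 2 - 1) * s / 2) ^ 2 = tan (√(c ^ 2 - 1) * s / 2) ^ 2 + 1 := by
    rw [tan_eq_sin_div_cos, div_pow, sin_sq]
    field_simp
    ring
  simp only [Function.comp_apply, mul_pow, hr, hsec, mul_one]
  calc _ = √((c - 1) / (c + 1)) * √(c ^ 2 - 1) * ((tan (√(c ^ 2 - 1) * s / 2) ^ 2 + 1) /
          ((c - 1) / (c + 1) * tan (√(c ^ 2 - 1) * s / 2) ^ 2 + 1)) - c := by ring
    _ = _ := by
      rw [hratio, hrμ]
      field_simp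
      ring

/-- For `c > 1` and `μ = √(c² − 1)`, the explicit curve of constant weighted curvature `c`
satisfies `x'(s) = (−c·cos(μs) − 1)/(c + cos(μs))` and its Euclidean signed curvature is
`x'y'' − x''y' = (c² − 1)/(c + cos(μs))` on `(−π/μ, π/μ)`. -/
theorem tangent_and_euclidean_curvature_large (c : ℝ) (hc : 1 < c) :
    let μ : ℝ := Real.sqrt (c ^ 2 - 1)
    let x : ℝ → ℝ := fun s =>
      2 * arctan (Real.sqrt ((c - 1) / (c + 1)) * tan (μ * s / 2)) - c * s
    let y : ℝ → ℝ := fun s =>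
      -log ((tan (μ * s / 2) ^ 2 + 1) / ((c - 1) / (c + 1) * tan (μ * s / 2) ^ 2 + 1))
    ∀ s ∈ Set.Ioo (-(π / μ)) (π / μ),
      deriv x s = (-c * cos (μ * s) - 1) / (c + cos (μ * s)) ∧
      deriv x s * deriv (deriv y) s - deriv (deriv x) s * deriv y s
        = (c ^ 2 - 1) / (c + cos (μ * s)) := by
  intro μ x y s hs
  have hμ2 : μ ^ 2 = c ^ 2 - 1 := sq_sqrt (by nlinarith)
  have hμ : 0 < μ := sqrt_pos.mpr (by nlinarith)
  have hD (t : ℝ) : c + cos (μ * t) ≠ 0 := by linarith [neg_one_le_cos (μ * t)]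
  have hcos : ∀ t ∈ Set.Ioo (-(π / μ)) (π / μ), cos (μ * t / 2) ≠ 0 := by
    rintro t ⟨h₁, h₂⟩
    rw [← neg_div, div_lt_iff₀ hμ] at h₁
    rw [lt_div_iff₀ hμ] at h₂
    exact (cos_pos_of_mem_Ioo ⟨by linarith, by linarith⟩).ne'
  have hx : Set.EqOn (deriv x) (fun t => (-c * cos (μ * t) - 1) / (c + cos (μ * t)))
      (Set.Ioo (-(π / μ)) (π / μ)) :=
    fun t ht => (hasDerivAt_two_mul_arctan_sub hc (hcos t ht)).deriv
  have hyeq : Set.EqOn y (fun t => log (c + cos (μ * t)) - log (c + 1))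
      (Set.Ioo (-(π / μ)) (π / μ)) := by
    intro t ht
    simp only [y]
    rw [tan_sq_add_one_div_eq hc (hcos t ht), log_div (by linarith) (hD t), neg_sub]
  have hy : Set.EqOn (deriv y) (fun t => -(μ * sin (μ * t)) / (c + cos (μ * t)))
      (Set.Ioo (-(π / μ)) (π / μ)) := by
    intro t ht
    rw [hyeq.deriv isOpen_Ioo ht]
    exact (((hasDerivAt_add_cos_mul c μ t).log (hD t)).sub_const _).deriv
  have hcosd : HasDerivAt (fun t => cos (μ * t)) (-(μ * sin (μ * s))) s := by
    simpa using hasDerivAt_add_cos_mul 0 μ s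
  have hsind : HasDerivAt (fun t => sin (μ * t)) (cos (μ * s) * μ) s := by
    simpa using ((hasDerivAt_id s).const_mul μ).sin
  have hxx : deriv (deriv x) s = (c ^ 2 - 1) * μ * sin (μ * s) / (c + cos (μ * s)) ^ 2 := by
    rw [hx.deriv isOpen_Ioo hs]
    refine ((((hcosd.const_mul (-c)).sub_const 1).div
      (hasDerivAt_add_cos_mul c μ s) (hD s)).congr_deriv ?_).deriv
    ring
  have hyy : deriv (deriv y) s = -(μ ^ 2 * (c * cos (μ * s) + 1)) / (c + cos (μ * s)) ^ 2 := by
    rw [hy.deriv isOpen_Ioo hs]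
    refine (((hsind.const_mul μ).neg.div
      (hasDerivAt_add_cos_mul c μ s) (hD s)).congr_deriv ?_).deriv
    simp only [Pi.neg_apply]
    congr 1
    linear_combination -μ ^ 2 * sin_sq_add_cos_sq (μ * s)
  refine ⟨hx hs, ?_⟩
  rw [hxx, hyy, hx hs, hy hs, ← hμ2]
  have hDs := hD s
  field_simp
  rw [sin_sq, hμ2]
  ring
end
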